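/- Consider an L-layer transformer with H heads per layer whose activation σ is L_lip-Lipschitz and all of whose weight matrices have Frobenius norm at most B, an arbitrary lazy layer set 𝓘 ⊆ {1,…,L}, and discard sets 𝓜_i ⊆ {1,…,i}. Let e_X^{(L)} = ‖X^{(L)} − X̃^{(L)}‖_{2,∞} denote the ℓ_{2,∞} error between the final hidden states of the original transformer and of the LightTransfer network, and for l ∈ 𝓘 let s_l = max_{i∈[N]} (1/H) Σ_{h=1}^H Σ_{j∈𝓜_i} [A_h^{(l)}]_{ij}, where A_h^{(l)} is the causal attention matrix of head h at layer l computed on LN(X^{(l−1)}). Then e_X^{(L)} ≤ 2L·(H·B + L_lip·B² + 4·H·B³) + 2·H·(B + L_lip·B³)·Σ_{i∈𝓘} s_i. -/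

import Mathlib

open scoped BigOperators
open Matrix

/-- The Euclidean (ℓ²) norm on `ℝ^d`. -/
noncomputable def l2norm {d : ℕ} (x : Fin d → ℝ) : ℝ := Real.sqrt (∑ i, x i ^ 2)

/-- The ℓ_{2,∞} norm of a matrix: the maximum ℓ² norm of its rows. -/
noncomputable def norm2inf {N d : ℕ} (X : Matrix (Fin N) (Fin d) ℝ) : ℝ :=
  ⨆ i, l2norm (X i)

/-- The Frobenius norm of a matrix. -/
noncomputable def frobNorm {m n : ℕ} (A : Matrix (Fin m) (Fin n) ℝ) : ℝ :=
  Real.sqrt (∑ i, ∑ j, A i j ^ 2)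

/-- The normalization map: `LN x = x` if `‖x‖₂ ≤ 1` and `LN x = x / ‖x‖₂` otherwise. -/
noncomputable def LN {d : ℕ} (x : Fin d → ℝ) : Fin d → ℝ :=
  if l2norm x ≤ 1 then x else (l2norm x)⁻¹ • x

/-- Row-wise application of `LN` to a matrix. -/
noncomputable def matLN {N d : ℕ} (X : Matrix (Fin N) (Fin d) ℝ) :
    Matrix (Fin N) (Fin d) ℝ :=
  Matrix.of fun i => LN (X i)

/-- The causal attention matrix of a single head. -/
noncomputable def causalAttn {N d dk : ℕ} (X : Matrix (Fin N) (Fin d) ℝ)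
    (WQ WK : Matrix (Fin d) (Fin dk) ℝ) : Matrix (Fin N) (Fin N) ℝ :=
  Matrix.of fun i j =>
    if j ≤ i then
      Real.exp ((X * WQ * (X * WK)ᵀ) i j) /
        ∑ k ∈ Finset.univ.filter (fun k : Fin N => k ≤ i),
          Real.exp ((X * WQ * (X * WK)ᵀ) i k)
    else 0

/-- Causal multi-head attention: `mha(X) = ∑_h A_h X W_{V,h}`. -/
noncomputable def mha {N d dk H : ℕ} (X : Matrix (Fin N) (Fin d) ℝ)
    (WQ WK : Fin H → Matrix (Fin d) (Fin dk) ℝ)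
    (WV : Fin H → Matrix (Fin d) (Fin d) ℝ) : Matrix (Fin N) (Fin d) ℝ :=
  ∑ h, causalAttn X (WQ h) (WK h) * X * WV h

/-- The lazy-masked attention matrix of a single head, given discard sets `M i ⊆ {0,…,i}`:
attention of row `i` is restricted to indices `j ≤ i` with `j ∉ M i` and renormalized. -/
noncomputable def lazyAttn {N d dk : ℕ} (X : Matrix (Fin N) (Fin d) ℝ)
    (WQ WK : Matrix (Fin d) (Fin dk) ℝ) (M : Fin N → Finset (Fin N)) :
    Matrix (Fin N) (Fin N) ℝ :=
  Matrix.of fun i j =>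
    if j ≤ i ∧ j ∉ M i then
      Real.exp ((X * WQ * (X * WK)ᵀ) i j) /
        ∑ k ∈ Finset.univ.filter (fun k : Fin N => k ≤ i ∧ k ∉ M i),
          Real.exp ((X * WQ * (X * WK)ᵀ) i k)
    else 0

/-- Lazy-masked causal multi-head attention. -/
noncomputable def lazyMha {N d dk H : ℕ} (X : Matrix (Fin N) (Fin d) ℝ)
    (WQ WK : Fin H → Matrix (Fin d) (Fin dk) ℝ)
    (WV : Fin H → Matrix (Fin d) (Fin d) ℝ) (M : Fin N → Finset (Fin N)) :
    Matrix (Fin N) (Fin d) ℝ :=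
  ∑ h, lazyAttn X (WQ h) (WK h) M * X * WV h

/-- The feed-forward module `ffn(X) = σ(X W₁) W₂`, with `σ` applied entrywise. -/
noncomputable def ffn {N d : ℕ} (σ : ℝ → ℝ) (X : Matrix (Fin N) (Fin d) ℝ)
    (W₁ W₂ : Matrix (Fin d) (Fin d) ℝ) : Matrix (Fin N) (Fin d) ℝ :=
  (X * W₁).map σ * W₂

/-- Hidden states of the original pre-norm transformer: `X⁽⁰⁾ = X` and
`Y⁽ⁱ⁾ = X⁽ⁱ⁻¹⁾ + mha⁽ⁱ⁾(LN(X⁽ⁱ⁻¹⁾))`, `X⁽ⁱ⁾ = Y⁽ⁱ⁾ + ffn⁽ⁱ⁾(LN(Y⁽ⁱ⁾))`,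
where layer `i` uses the weights with index `i`. -/
noncomputable def hiddenStates {N d dk H : ℕ} (σ : ℝ → ℝ)
    (WQ WK : ℕ → Fin H → Matrix (Fin d) (Fin dk) ℝ)
    (WV : ℕ → Fin H → Matrix (Fin d) (Fin d) ℝ)
    (WA1 WA2 : ℕ → Matrix (Fin d) (Fin d) ℝ)
    (X : Matrix (Fin N) (Fin d) ℝ) : ℕ → Matrix (Fin N) (Fin d) ℝ
  | 0 => X
  | i + 1 =>
    let Xp := hiddenStates σ WQ WK WV WA1 WA2 X i
    let Y := Xp + mha (matLN Xp) (WQ (i + 1)) (WK (i + 1)) (WV (i + 1))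
    Y + ffn σ (matLN Y) (WA1 (i + 1)) (WA2 (i + 1))

/-- Hidden states of the LightTransfer network with lazy-layer set `I` and discard sets `M`:
layers in `I` use the lazy-masked attention `mha~` instead of `mha`. -/
noncomputable def ltHiddenStates {N d dk H : ℕ} (σ : ℝ → ℝ)
    (WQ WK : ℕ → Fin H → Matrix (Fin d) (Fin dk) ℝ)
    (WV : ℕ → Fin H → Matrix (Fin d) (Fin d) ℝ)
    (WA1 WA2 : ℕ → Matrix (Fin d) (Fin d) ℝ)
    (I : Finset ℕ) (M : Fin N → Finset (Fin N))
    (X : Matrix (Fin N) (Fin d) ℝ) : ℕ → Matrix (Fin N) (Fin d) ℝ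
  | 0 => X
  | i + 1 =>
    let Xp := ltHiddenStates σ WQ WK WV WA1 WA2 I M X i
    let Y := Xp +
      (if i + 1 ∈ I then lazyMha (matLN Xp) (WQ (i + 1)) (WK (i + 1)) (WV (i + 1)) M
       else mha (matLN Xp) (WQ (i + 1)) (WK (i + 1)) (WV (i + 1)))
    Y + ffn σ (matLN Y) (WA1 (i + 1)) (WA2 (i + 1))

theorem l2norm_eq_norm {d : ℕ} (x : Fin d → ℝ) : l2norm x = ‖WithLp.toLp 2 x‖ := by
  simp [l2norm, EuclideanSpace.norm_eq]

theorem l2norm_nonneg {d : ℕ} (x : Fin d → ℝ) : 0 ≤ l2norm x := Real.sqrt_nonneg _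

theorem l2norm_add_le {d : ℕ} (x y : Fin d → ℝ) : l2norm (x + y) ≤ l2norm x + l2norm y := by
  simp only [l2norm_eq_norm, WithLp.toLp_add]
  exact norm_add_le _ _

theorem l2norm_sub_le {d : ℕ} (x y : Fin d → ℝ) : l2norm (x - y) ≤ l2norm x + l2norm y := by
  simp only [l2norm_eq_norm, WithLp.toLp_sub]
  exact norm_sub_le _ _

theorem l2norm_smul {d : ℕ} (c : ℝ) (x : Fin d → ℝ) : l2norm (c • x) = |c| * l2norm x := by
  simp only [l2norm_eq_norm, WithLp.toLp_smul, norm_smul, Real.norm_eq_abs]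

theorem l2norm_sum_le {d : ℕ} {ι : Type*} (t : Finset ι) (f : ι → Fin d → ℝ) :
    l2norm (∑ j ∈ t, f j) ≤ ∑ j ∈ t, l2norm (f j) := by
  simp only [l2norm_eq_norm, WithLp.toLp_sum]
  exact norm_sum_le _ _

theorem l2norm_vecMul_le {m n : ℕ} (x : Fin m → ℝ) (W : Matrix (Fin m) (Fin n) ℝ) :
    l2norm (x ᵥ* W) ≤ l2norm x * frobNorm W := by
  unfold l2norm frobNorm
  rw [← Real.sqrt_mul (Finset.sum_nonneg fun i _ => sq_nonneg (x i))]
  apply Real.sqrt_le_sqrt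
  rw [Finset.sum_comm (f := fun i j => W i j ^ 2), Finset.mul_sum]
  exact Finset.sum_le_sum fun j _ =>
    Finset.sum_mul_sq_le_sq_mul_sq Finset.univ x fun i => W i j

theorem l2norm_LN_le_one {d : ℕ} (x : Fin d → ℝ) : l2norm (LN x) ≤ 1 := by
  unfold LN
  split_ifs with h
  · exact h
  · have h1 : 0 < l2norm x := by linarith
    rw [l2norm_smul, abs_of_pos (inv_pos.2 h1), inv_mul_cancel₀ h1.ne']

theorem l2norm_map_sub_map_le {d : ℕ} {σ : ℝ → ℝ} {K : ℝ} (hK : 0 ≤ K)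
    (hσ : ∀ x y : ℝ, |σ x - σ y| ≤ K * |x - y|) (x y : Fin d → ℝ) :
    l2norm (fun j => σ (x j) - σ (y j)) ≤ K * l2norm (x - y) := by
  rw [← abs_of_nonneg hK, ← l2norm_smul]
  refine Real.sqrt_le_sqrt (Finset.sum_le_sum fun j _ => sq_le_sq.2 ?_)
  simpa [abs_mul, abs_of_nonneg hK] using hσ (x j) (y j)

/-- A sub-stochastic combination of rows of norm at most `1` has norm at most `1`. -/
theorem l2norm_row_mul_le_one {N d : ℕ} {A : Matrix (Fin N) (Fin N) ℝ}
    {X : Matrix (Fin N) (Fin d) ℝ} (hX : ∀ j, l2norm (X j) ≤ 1) {i : Fin N}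
    (h0 : ∀ j, 0 ≤ A i j) (h1 : ∑ j, A i j ≤ 1) : l2norm ((A * X) i) ≤ 1 := by
  have h : (A * X) i = ∑ j, A i j • X j := by
    ext k
    simp [Matrix.mul_apply, Finset.sum_apply]
  rw [h]
  refine (l2norm_sum_le _ _).trans (le_trans (Finset.sum_le_sum fun j _ => ?_) h1)
  rw [l2norm_smul, abs_of_nonneg (h0 j)]
  exact mul_le_of_le_one_right (h0 j) (hX j)

theorem sum_ite_div_sum_filter_le_one {ι : Type*} [Fintype ι] (p : ι → Prop) [DecidablePred p]
    (f : ι → ℝ) :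
    ∑ j, (if p j then f j / ∑ k ∈ Finset.univ.filter p, f k else 0) ≤ 1 := by
  rw [← Finset.sum_filter, ← Finset.sum_div]
  exact div_self_le_one _

theorem causalAttn_nonneg {N d dk : ℕ} (X : Matrix (Fin N) (Fin d) ℝ)
    (WQ WK : Matrix (Fin d) (Fin dk) ℝ) (i j : Fin N) : 0 ≤ causalAttn X WQ WK i j := by
  simp only [causalAttn, Matrix.of_apply]
  split_ifs <;> positivity

theorem causalAttn_row_sum_le_one {N d dk : ℕ} (X : Matrix (Fin N) (Fin d) ℝ)
    (WQ WK : Matrix (Fin d) (Fin dk) ℝ) (i : Fin N) : ∑ j, causalAttn X WQ WK i j ≤ 1 :=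
  sum_ite_div_sum_filter_le_one _ _

theorem lazyAttn_nonneg {N d dk : ℕ} (X : Matrix (Fin N) (Fin d) ℝ)
    (WQ WK : Matrix (Fin d) (Fin dk) ℝ) (M : Fin N → Finset (Fin N)) (i j : Fin N) :
    0 ≤ lazyAttn X WQ WK M i j := by
  simp only [lazyAttn, Matrix.of_apply]
  split_ifs <;> positivity

theorem lazyAttn_row_sum_le_one {N d dk : ℕ} (X : Matrix (Fin N) (Fin d) ℝ)
    (WQ WK : Matrix (Fin d) (Fin dk) ℝ) (M : Fin N → Finset (Fin N)) (i : Fin N) :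
    ∑ j, lazyAttn X WQ WK M i j ≤ 1 :=
  sum_ite_div_sum_filter_le_one _ _

theorem l2norm_row_sum_heads_le {N d H : ℕ} {B : ℝ}
    {A : Fin H → Matrix (Fin N) (Fin N) ℝ} {X : Matrix (Fin N) (Fin d) ℝ}
    {WV : Fin H → Matrix (Fin d) (Fin d) ℝ} (hWV : ∀ h, frobNorm (WV h) ≤ B)
    (hX : ∀ j, l2norm (X j) ≤ 1) {i : Fin N}
    (h0 : ∀ h j, 0 ≤ A h i j) (h1 : ∀ h, ∑ j, A h i j ≤ 1) :
    l2norm ((∑ h, A h * X * WV h) i) ≤ H * B := by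
  have hsum : (∑ h, A h * X * WV h) i = ∑ h, (A h * X * WV h) i := by
    ext k
    simp [Matrix.sum_apply, Finset.sum_apply]
  rw [hsum]
  refine (l2norm_sum_le _ _).trans ?_
  have key : ∀ h ∈ Finset.univ, l2norm ((A h * X * WV h) i) ≤ B := fun h _ => by
    rw [Matrix.mul_apply_eq_vecMul]
    refine (l2norm_vecMul_le _ _).trans (le_trans ?_ (hWV h))
    exact mul_le_of_le_one_left (Real.sqrt_nonneg _)
      (l2norm_row_mul_le_one hX (h0 h) (h1 h))
  simpa using Finset.sum_le_sum key

theorem l2norm_mha_le {N d dk H : ℕ} {B : ℝ} {X : Matrix (Fin N) (Fin d) ℝ}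
    (WQ WK : Fin H → Matrix (Fin d) (Fin dk) ℝ) {WV : Fin H → Matrix (Fin d) (Fin d) ℝ}
    (hWV : ∀ h, frobNorm (WV h) ≤ B) (hX : ∀ j, l2norm (X j) ≤ 1) (i : Fin N) :
    l2norm (mha X WQ WK WV i) ≤ H * B :=
  l2norm_row_sum_heads_le hWV hX (fun _ _ => causalAttn_nonneg _ _ _ _ _)
    (fun _ => causalAttn_row_sum_le_one _ _ _ _)

theorem l2norm_lazyMha_le {N d dk H : ℕ} {B : ℝ} {X : Matrix (Fin N) (Fin d) ℝ}
    (WQ WK : Fin H → Matrix (Fin d) (Fin dk) ℝ) {WV : Fin H → Matrix (Fin d) (Fin d) ℝ}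
    (M : Fin N → Finset (Fin N))
    (hWV : ∀ h, frobNorm (WV h) ≤ B) (hX : ∀ j, l2norm (X j) ≤ 1) (i : Fin N) :
    l2norm (lazyMha X WQ WK WV M i) ≤ H * B :=
  l2norm_row_sum_heads_le hWV hX (fun _ _ => lazyAttn_nonneg _ _ _ _ _ _)
    (fun _ => lazyAttn_row_sum_le_one _ _ _ _ _)

theorem l2norm_ffn_sub_ffn_le {N d : ℕ} {σ : ℝ → ℝ} {K B : ℝ} (hK : 0 ≤ K) (hB : 0 ≤ B)
    (hσ : ∀ x y : ℝ, |σ x - σ y| ≤ K * |x - y|) {X Y : Matrix (Fin N) (Fin d) ℝ}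
    {W₁ W₂ : Matrix (Fin d) (Fin d) ℝ} (h₁ : frobNorm W₁ ≤ B) (h₂ : frobNorm W₂ ≤ B)
    (i : Fin N) :
    l2norm (ffn σ X W₁ W₂ i - ffn σ Y W₁ W₂ i) ≤ K * B ^ 2 * l2norm (X i - Y i) := by
  have h : ffn σ X W₁ W₂ i - ffn σ Y W₁ W₂ i =
      (fun j => σ ((X i ᵥ* W₁) j) - σ ((Y i ᵥ* W₁) j)) ᵥ* W₂ := by
    simp only [ffn, Matrix.mul_apply_eq_vecMul]
    rw [← Matrix.sub_vecMul]
    rfl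
  have hn := l2norm_nonneg (X i - Y i)
  calc l2norm (ffn σ X W₁ W₂ i - ffn σ Y W₁ W₂ i)
      ≤ l2norm (fun j => σ ((X i ᵥ* W₁) j) - σ ((Y i ᵥ* W₁) j)) * frobNorm W₂ := by
        rw [h]
        exact l2norm_vecMul_le _ _
    _ ≤ (K * l2norm (X i ᵥ* W₁ - Y i ᵥ* W₁)) * B :=
        mul_le_mul (l2norm_map_sub_map_le hK hσ _ _) h₂ (Real.sqrt_nonneg _)
          (mul_nonneg hK (l2norm_nonneg _))
    _ ≤ (K * (l2norm (X i - Y i) * B)) * B := by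
        rw [← Matrix.sub_vecMul]
        gcongr
        exact (l2norm_vecMul_le _ _).trans (by gcongr)
    _ = K * B ^ 2 * l2norm (X i - Y i) := by ring

/-- Normalization bounds every layer's contribution to the error, whatever the current states. -/
theorem l2norm_hiddenStates_sub_ltHiddenStates_le {L H N d dk : ℕ} {B K : ℝ}
    (hB : 0 ≤ B) (hK : 0 ≤ K) {σ : ℝ → ℝ} (hσ : ∀ x y : ℝ, |σ x - σ y| ≤ K * |x - y|)
    (WQ WK : ℕ → Fin H → Matrix (Fin d) (Fin dk) ℝ)
    {WV : ℕ → Fin H → Matrix (Fin d) (Fin d) ℝ} {WA1 WA2 : ℕ → Matrix (Fin d) (Fin d) ℝ}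
    (hWV : ∀ l, 1 ≤ l → l ≤ L → ∀ h, frobNorm (WV l h) ≤ B)
    (hWA1 : ∀ l, 1 ≤ l → l ≤ L → frobNorm (WA1 l) ≤ B)
    (hWA2 : ∀ l, 1 ≤ l → l ≤ L → frobNorm (WA2 l) ≤ B)
    (I : Finset ℕ) (M : Fin N → Finset (Fin N)) (X : Matrix (Fin N) (Fin d) ℝ) (i : Fin N) :
    ∀ l ≤ L, l2norm (hiddenStates σ WQ WK WV WA1 WA2 X l i -
        ltHiddenStates σ WQ WK WV WA1 WA2 I M X l i) ≤ l * (2 * (H * B + K * B ^ 2)) := by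
  intro l
  induction l with
  | zero => simp [hiddenStates, ltHiddenStates, l2norm]
  | succ l ih =>
    intro hl
    have ih := ih (by omega)
    have hl1 : 1 ≤ l + 1 := by omega
    simp only [hiddenStates, ltHiddenStates]
    set P := hiddenStates σ WQ WK WV WA1 WA2 X l
    set Q := ltHiddenStates σ WQ WK WV WA1 WA2 I M X l
    have hLN : ∀ (Z : Matrix (Fin N) (Fin d) ℝ) (j : Fin N), l2norm (matLN Z j) ≤ 1 :=
      fun Z j => l2norm_LN_le_one (Z j)
    set S := mha (matLN P) (WQ (l + 1)) (WK (l + 1)) (WV (l + 1))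
    set T := if l + 1 ∈ I then lazyMha (matLN Q) (WQ (l + 1)) (WK (l + 1)) (WV (l + 1)) M
       else mha (matLN Q) (WQ (l + 1)) (WK (l + 1)) (WV (l + 1)) with hT
    have hS : l2norm (S i) ≤ H * B := l2norm_mha_le _ _ (hWV _ hl1 hl) (hLN P) i
    have hTle : l2norm (T i) ≤ H * B := by
      rw [hT]
      split_ifs
      · exact l2norm_lazyMha_le _ _ M (hWV _ hl1 hl) (hLN Q) i
      · exact l2norm_mha_le _ _ (hWV _ hl1 hl) (hLN Q) i
    have hF : l2norm (ffn σ (matLN (P + S)) (WA1 (l + 1)) (WA2 (l + 1)) i -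
        ffn σ (matLN (Q + T)) (WA1 (l + 1)) (WA2 (l + 1)) i) ≤ K * B ^ 2 * 2 := by
      refine (l2norm_ffn_sub_ffn_le hK hB hσ (hWA1 _ hl1 hl) (hWA2 _ hl1 hl) i).trans ?_
      gcongr
      exact (l2norm_sub_le _ _).trans (by linarith [hLN (P + S) i, hLN (Q + T) i])
    set F := ffn σ (matLN (P + S)) (WA1 (l + 1)) (WA2 (l + 1))
    set G := ffn σ (matLN (Q + T)) (WA1 (l + 1)) (WA2 (l + 1))
    have hsplit : (P + S + F) i - (Q + T + G) i = (P i - Q i) + (S i - T i) + (F i - G i) := by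
      ext k
      simp only [Matrix.add_apply, Pi.add_apply, Pi.sub_apply]
      ring
    rw [hsplit]
    have a1 := l2norm_add_le ((P i - Q i) + (S i - T i)) (F i - G i)
    have a2 := l2norm_add_le (P i - Q i) (S i - T i)
    have a3 := l2norm_sub_le (S i) (T i)
    push_cast
    linarith

/-- Final hidden-state error bound of Theorem 2 (Eqn. (err_L)):
`e⁽ᴸ⁾ ≤ 2L(HB + L_lip B² + 4HB³) + 2H(B + L_lip B³) ∑_{i∈𝓘} sᵢ`. -/
theorem lighttransfer_hidden_error_final {L H N d dk : ℕ} (B L_lip : ℝ)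
    (hB : 0 < B) (hL_lip : 0 < L_lip)
    (σ : ℝ → ℝ) (hσ : ∀ x y : ℝ, |σ x - σ y| ≤ L_lip * |x - y|)
    (WQ WK : ℕ → Fin H → Matrix (Fin d) (Fin dk) ℝ)
    (WV : ℕ → Fin H → Matrix (Fin d) (Fin d) ℝ)
    (WA1 WA2 : ℕ → Matrix (Fin d) (Fin d) ℝ)
    (hWQ : ∀ l, 1 ≤ l → l ≤ L → ∀ h, frobNorm (WQ l h) ≤ B)
    (hWK : ∀ l, 1 ≤ l → l ≤ L → ∀ h, frobNorm (WK l h) ≤ B)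
    (hWV : ∀ l, 1 ≤ l → l ≤ L → ∀ h, frobNorm (WV l h) ≤ B)
    (hWA1 : ∀ l, 1 ≤ l → l ≤ L → frobNorm (WA1 l) ≤ B)
    (hWA2 : ∀ l, 1 ≤ l → l ≤ L → frobNorm (WA2 l) ≤ B)
    (I : Finset ℕ) (hI : I ⊆ Finset.Icc 1 L)
    (M : Fin N → Finset (Fin N)) (hM : ∀ i : Fin N, ∀ j ∈ M i, j ≤ i)
    (X : Matrix (Fin N) (Fin d) ℝ)
    (s : ℕ → ℝ)
    (hs : ∀ l, s l = ⨆ i : Fin N, (1 / (H : ℝ)) * ∑ h, ∑ j ∈ M i,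
        causalAttn (matLN (hiddenStates σ WQ WK WV WA1 WA2 X (l - 1)))
          (WQ l h) (WK l h) i j) :
    norm2inf (hiddenStates σ WQ WK WV WA1 WA2 X L -
        ltHiddenStates σ WQ WK WV WA1 WA2 I M X L) ≤
      2 * L * (H * B + L_lip * B ^ 2 + 4 * H * B ^ 3)
        + 2 * H * (B + L_lip * B ^ 3) * ∑ i ∈ I, s i := by
  have hs0 : 0 ≤ ∑ i ∈ I, s i := by
    refine Finset.sum_nonneg fun l _ => ?_
    rw [hs]
    refine Real.iSup_nonneg fun i => mul_nonneg (by positivity) ?_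
    exact Finset.sum_nonneg fun h _ => Finset.sum_nonneg fun j _ => causalAttn_nonneg _ _ _ _ _
  refine Real.iSup_le (fun i => ?_) (by positivity)
  calc _ ≤ (L : ℝ) * (2 * (H * B + L_lip * B ^ 2)) :=
        l2norm_hiddenStates_sub_ltHiddenStates_le hB.le hL_lip.le hσ WQ WK hWV hWA1 hWA2 I M X i
          L le_rfl
    _ ≤ 2 * L * (H * B + L_lip * B ^ 2 + 4 * H * B ^ 3) := by
        have : 0 ≤ (L : ℝ) * (H * B ^ 3) := by positivity
        linarith
    _ ≤ _ := le_add_of_nonneg_right (by positivity)
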